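/- arXiv:2210.16672 — 9 statements merged into one kernel-verified Lean document; each statement's English description precedes it below -/
import Mathlib

section
/- Let m, n > 2 be odd coprime integers such that q = 2mn + 1 is a prime power. Let X be the subgroup of F_q^* of order m and Y the subgroup of F_q^* of order n. Then the map (x,y) ↦ xy is injective on X × Y, the product set X·Y is a half-set of (F_q, +), and consequently, for any enumerations x_1,…,x_m of X and y_1,…,y_n of Y, the m×n matrix A with entries a_{i,j} = x_i y_j is a rank-one Heffter array H(m,n) over F_q. -/
open scoped Classical Pointwise

/-- A half-set of the additive group of a finite field `F` of odd order `2ℓ+1`: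
an `ℓ`-subset `L` with `L ∪ (-L) = F \ {0}`. -/
def IsHalfSet {F : Type*} [Field F] [Fintype F] (L : Finset F) : Prop :=
  2 * L.card + 1 = Fintype.card F ∧
  L ∪ L.image (fun z => -z) = Finset.univ \ {0}

/-- A (tight) Heffter array `H(m,n)` over `F`: an `m × n` matrix with pairwise
distinct entries whose set of entries is a half-set of `(F,+)` and all of whose
row sums and column sums are zero. -/
def IsHeffter {F : Type*} [Field F] [Fintype F] {m n : ℕ}
    (A : Matrix (Fin m) (Fin n) F) : Prop :=
  Function.Injective (fun p : Fin m × Fin n => A p.1 p.2) ∧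
  IsHalfSet (Finset.image (fun p : Fin m × Fin n => A p.1 p.2) Finset.univ) ∧
  (∀ i, ∑ j, A i j = 0) ∧ (∀ j, ∑ i, A i j = 0)

/-- A multiplier of an `m × n` Heffter array `A` over `F`: a nonzero `u ∈ F` such
that either `u·a_{i,j} = a_{σ(i),τ(j)}` for permutations `σ`, `τ` of the rows and
columns, or (possible only when `m = n`) `u·a_{i,j} = a_{τ(j),σ(i)}`. -/
def IsMultiplier {F : Type*} [Field F] {m n : ℕ}
    (A : Matrix (Fin m) (Fin n) F) (u : F) : Prop :=
  u ≠ 0 ∧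
  ((∃ (σ : Equiv.Perm (Fin m)) (τ : Equiv.Perm (Fin n)),
      ∀ i j, u * A i j = A (σ i) (τ j)) ∨
   (∃ (σ : Fin m ≃ Fin n) (τ : Fin n ≃ Fin m),
      ∀ i j, u * A i j = A (τ j) (σ i)))

theorem eq_one_of_pow_eq_one_of_coprime {G : Type*} [Monoid G] {m n : ℕ}
    (hmn : Nat.Coprime m n) {u : G} (hum : u ^ m = 1) (hun : u ^ n = 1) : u = 1 :=
  orderOf_eq_one_iff.mp <| Nat.dvd_one.mp <| hmn ▸
    Nat.dvd_gcd (orderOf_dvd_of_pow_eq_one hum) (orderOf_dvd_of_pow_eq_one hun)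

theorem exists_mul_eq_of_pow_mul_eq_one {F : Type*} [Field F] {m n : ℕ}
    (hmn : Nat.Coprime m n) {w : F} (hw0 : w ≠ 0) (hw : w ^ (m * n) = 1) :
    ∃ x y : F, x ^ m = 1 ∧ y ^ n = 1 ∧ x * y = w := by
  have hwz : w ^ ((m : ℤ) * n) = 1 := by exact_mod_cast hw
  refine ⟨w ^ ((n : ℤ) * Nat.gcdB m n), w ^ ((m : ℤ) * Nat.gcdA m n), ?_, ?_, ?_⟩
  · rw [← zpow_natCast, ← zpow_mul,
      show (n : ℤ) * Nat.gcdB m n * m = (m : ℤ) * n * Nat.gcdB m n by ring, zpow_mul, hwz,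
      one_zpow]
  · rw [← zpow_natCast, ← zpow_mul,
      show (m : ℤ) * Nat.gcdA m n * n = (m : ℤ) * n * Nat.gcdA m n by ring, zpow_mul, hwz,
      one_zpow]
  · have hbezout := Nat.gcd_eq_gcd_ab m n
    rw [hmn.gcd_eq_one, Nat.cast_one] at hbezout
    rw [← zpow_add₀ hw0, add_comm, ← hbezout, zpow_one]

/-- If `k` is odd and `F` has order `2k+1`, the `k`-th roots of unity form a half-set. -/
theorem isHalfSet_of_mem_iff_pow_eq_one {F : Type*} [Field F] [Fintype F] {k : ℕ} (hk : Odd k)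
    (hq : Fintype.card F = 2 * k + 1) {L : Finset F} (hL : ∀ z : F, z ∈ L ↔ z ^ k = 1) :
    IsHalfSet L := by
  have hchar : ringChar F ≠ 2 := fun h => by
    have := FiniteField.even_card_iff_char_two.mp h
    lia
  have hneg : ∀ z : F, z ∈ L.image (fun z => -z) ↔ z ^ k = -1 := fun z => by
    simp only [Finset.mem_image, hL]
    constructor
    · rintro ⟨a, ha, rfl⟩
      rw [hk.neg_pow, ha]
    · exact fun h => ⟨-z, by rw [hk.neg_pow, h, neg_neg], neg_neg z⟩
  have hunion : L ∪ L.image (fun z => -z) = Finset.univ \ {0} := by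
    ext z
    simp only [Finset.mem_union, hneg, hL, Finset.mem_sdiff, Finset.mem_univ, true_and,
      Finset.mem_singleton]
    constructor
    · rintro h rfl
      simp [hk.pos.ne'] at h
    · intro hz
      have hpow := FiniteField.pow_card_sub_one_eq_one z hz
      rw [hq, Nat.add_sub_cancel, mul_comm, pow_mul] at hpow
      exact by simpa using hpow
  have hdisj : Disjoint L (L.image (fun z => -z)) := by
    rw [Finset.disjoint_left]
    intro z hz hz'
    rw [hL] at hz
    rw [hneg, hz] at hz'
    exact Ring.neg_one_ne_one_of_char_ne_two hchar hz'.symm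
  refine ⟨?_, hunion⟩
  have hcard := congrArg Finset.card hunion
  rw [Finset.card_union_of_disjoint hdisj, Finset.card_image_of_injective _ neg_injective,
    Finset.card_sdiff_of_subset (Finset.subset_univ _), Finset.card_univ,
    Finset.card_singleton] at hcard
  lia

/-- A nontrivial finite group of roots of unity, enumerated injectively, has sum zero. -/
theorem sum_enumeration_roots_of_unity_eq_zero {F : Type*} [Field F] {n : ℕ} (hn : 1 < n)
    {Y : Finset F} (hY : ∀ z : F, z ∈ Y ↔ z ^ n = 1) {y : Fin n → F}
    (hy : Function.Injective y) (hyY : Finset.image y Finset.univ = Y) : ∑ j, y j = 0 := by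
  have hsum : ∑ j, y j = ∑ z ∈ Y, z := by
    rw [← hyY, Finset.sum_image hy.injOn]
  have hcard : 1 < Y.card := by
    rwa [← hyY, Finset.card_image_of_injective _ hy, Finset.card_fin]
  obtain ⟨u, huY, hu1⟩ := Finset.exists_mem_ne hcard 1
  rw [hY] at huY
  have hu0 : u ≠ 0 := by
    rintro rfl
    simp [show n ≠ 0 by lia] at huY
  have hshift : ∑ z ∈ Y, u * z = ∑ z ∈ Y, z := by
    refine Finset.sum_bijective (u * ·) (mulLeft_bijective₀ u hu0) (fun z => ?_) fun _ _ => rfl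
    rw [hY, hY, mul_pow, huY, one_mul]
  rw [← Finset.mul_sum] at hshift
  rw [hsum]
  have hzero : (u - 1) * ∑ z ∈ Y, z = 0 := by rw [sub_mul, hshift, one_mul, sub_self]
  exact (mul_eq_zero.mp hzero).resolve_left (sub_ne_zero.mpr hu1)

/-- Let `m, n > 2` be odd coprime with `q = 2mn + 1` a prime power, let
`X` be the subgroup of `Fˣ` of order `m` (the `m`-th roots of unity) and `Y` the
subgroup of order `n`. Then multiplication is injective on `X × Y`, the product set
`X·Y` is a half-set of `(F,+)`, and for any enumerations `x_1,…,x_m` of `X` and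
`y_1,…,y_n` of `Y` the matrix `[x_i y_j]` is a rank-one Heffter array `H(m,n)`. -/
theorem heffter_stmt_6 {F : Type*} [Field F] [Fintype F] (m n : ℕ)
    (hm : 2 < m) (hn : 2 < n) (hmo : Odd m) (hno : Odd n) (hmn : Nat.Coprime m n)
    (hq : Fintype.card F = 2 * m * n + 1)
    (X Y : Finset F) (hX : ∀ z : F, z ∈ X ↔ z ^ m = 1) (hY : ∀ z : F, z ∈ Y ↔ z ^ n = 1) :
    Set.InjOn (fun p : F × F => p.1 * p.2) ↑(X ×ˢ Y) ∧
    IsHalfSet ((X ×ˢ Y).image (fun p : F × F => p.1 * p.2)) ∧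
    ∀ (x : Fin m → F) (y : Fin n → F), Function.Injective x → Function.Injective y →
      Finset.image x Finset.univ = X → Finset.image y Finset.univ = Y →
      IsHeffter (Matrix.of fun i j => x i * y j) ∧
      (Matrix.of fun i j => x i * y j : Matrix (Fin m) (Fin n) F).rank = 1 := by
  have hX0 : ∀ {z : F}, z ∈ X → z ≠ 0 := by
    rintro z hz rfl
    simp [hX, show m ≠ 0 by lia] at hz
  have hY0 : ∀ {z : F}, z ∈ Y → z ≠ 0 := by
    rintro z hz rfl
    simp [hY, show n ≠ 0 by lia] at hz
  have hinj : Set.InjOn (fun p : F × F => p.1 * p.2) ↑(X ×ˢ Y) := by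
    rintro ⟨a, b⟩ hab ⟨c, d⟩ hcd h
    rw [Finset.mem_coe, Finset.mem_product] at hab hcd
    obtain ⟨ha, hb⟩ := hab
    obtain ⟨hc, hd⟩ := hcd
    dsimp only at h ha hb hc hd
    have hratio : a / c = d / b := by
      rw [div_eq_div_iff (hX0 hc) (hY0 hb), h, mul_comm]
    have hone : a / c = 1 := by
      refine eq_one_of_pow_eq_one_of_coprime hmn ?_ ?_
      · rw [div_pow, (hX a).mp ha, (hX c).mp hc, div_one]
      · rw [hratio, div_pow, (hY d).mp hd, (hY b).mp hb, div_one]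
    have hac : a = c := (div_eq_one_iff_eq (hX0 hc)).mp hone
    have hdb : d = b := (div_eq_one_iff_eq (hY0 hb)).mp (hratio ▸ hone)
    rw [hac, hdb]
  have hhalf : IsHalfSet ((X ×ˢ Y).image (fun p : F × F => p.1 * p.2)) := by
    refine isHalfSet_of_mem_iff_pow_eq_one (hmo.mul hno) (by rw [hq, mul_assoc]) fun z => ?_
    simp only [Finset.mem_image, Finset.mem_product, Prod.exists, hX, hY]
    constructor
    · rintro ⟨a, b, ⟨ha, hb⟩, rfl⟩
      rw [mul_pow, pow_mul, ha, one_pow, mul_comm m n, pow_mul, hb, one_pow, one_mul]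
    · intro hz
      have hz0 : z ≠ 0 := by
        rintro rfl
        simp [(hmo.mul hno).pos.ne'] at hz
      obtain ⟨a, b, ha, hb, hab⟩ := exists_mul_eq_of_pow_mul_eq_one hmn hz0 hz
      exact ⟨a, b, ⟨ha, hb⟩, hab⟩
  refine ⟨hinj, hhalf, fun x y hx hy hxX hyY => ?_⟩
  have hxmem : ∀ i, x i ∈ X := fun i => hxX ▸ Finset.mem_image_of_mem x (Finset.mem_univ i)
  have hymem : ∀ j, y j ∈ Y := fun j => hyY ▸ Finset.mem_image_of_mem y (Finset.mem_univ j)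
  refine ⟨⟨?_, ?_, fun i => ?_, fun j => ?_⟩, ?_⟩
  · rintro ⟨i, j⟩ ⟨i', j'⟩ h
    have hpair := hinj (Finset.mem_coe.mpr (Finset.mk_mem_product (hxmem i) (hymem j)))
      (Finset.mem_coe.mpr (Finset.mk_mem_product (hxmem i') (hymem j'))) h
    rw [Prod.mk.injEq] at hpair
    rw [hx hpair.1, hy hpair.2]
  · convert hhalf using 1
    rw [← hxX, ← hyY]
    ext z
    simp
  · simp only [Matrix.of_apply]
    rw [← Finset.mul_sum,
      sum_enumeration_roots_of_unity_eq_zero (by lia) hY hy hyY, mul_zero]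
  · simp only [Matrix.of_apply]
    rw [← Finset.sum_mul,
      sum_enumeration_roots_of_unity_eq_zero (by lia) hX hx hxX, zero_mul]
  · refine le_antisymm (Matrix.rank_vecMulVec_le x y) (Nat.one_le_iff_ne_zero.mpr fun h => ?_)
    rw [Matrix.rank, Submodule.finrank_eq_zero, LinearMap.range_eq_bot,
      ← Matrix.mulVecLin_zero] at h
    replace h := Matrix.mulVec_injective (congrArg DFunLike.coe h)
    have hentry := congrFun (congrFun h ⟨0, by lia⟩) ⟨0, by lia⟩
    exact mul_ne_zero (hX0 (hxmem _)) (hY0 (hymem _)) hentry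
end

section
/- Let A be a Heffter array H(m,n) over F_q, q = 2mn+1 a prime power, with entries a_{i,j} = x_i y_j where X = {x_1,…,x_m} and Y = {y_1,…,y_n} are subsets of F_q^* of sizes m and n (so A is rank-one with factors X, Y). Then the group M of multipliers of A equals the product S·T, where S = { u ∈ F_q^* : uX = X } and T = { u ∈ F_q^* : uY = Y } are the stabilizers of X and Y under the multiplication action of F_q^*. -/
open scoped Classical Pointwise

/-- A unit stabilizes the range of an injective finite family iff it permutes the family. -/
theorem image_mul_range_eq_iff {F ι : Type*} [Field F] [Finite ι] {x : ι → F}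
    (hx : Function.Injective x) (u : Fˣ) :
    (fun z => (u : F) * z) '' Set.range x = Set.range x ↔
      ∃ σ : Equiv.Perm ι, ∀ i, (u : F) * x i = x (σ i) := by
  constructor
  · intro h
    have hmem : ∀ i, ∃ k, (u : F) * x i = x k := fun i => by
      have hi : (u : F) * x i ∈ Set.range x := h ▸ ⟨x i, ⟨i, rfl⟩, rfl⟩
      obtain ⟨k, hk⟩ := hi
      exact ⟨k, hk.symm⟩
    choose f hf using hmem
    have hinj : Function.Injective f := fun i k hik =>
      hx (mul_left_cancel₀ u.ne_zero (by rw [hf, hf, hik]))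
    exact ⟨Equiv.ofBijective f (Finite.injective_iff_bijective.mp hinj), hf⟩
  · rintro ⟨σ, hσ⟩
    rw [← Set.range_comp, ← σ.surjective.range_comp x]
    exact congrArg Set.range (funext hσ)

/-- A rank-one Heffter array has no multiplier that interchanges rows and columns. -/
theorem IsHeffter.not_transpose_multiplier {F : Type*} [Field F] [Fintype F] {m n : ℕ}
    {x : Fin m → F} {y : Fin n → F} (hx0 : ∀ i, x i ≠ 0) (hy0 : ∀ j, y j ≠ 0)
    (hA : IsHeffter (Matrix.of fun i j => x i * y j)) (i₀ : Fin m) (j₀ : Fin n) {u : F}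
    (σ : Fin m ≃ Fin n) (τ : Fin n ≃ Fin m) :
    ¬ ∀ i j, u * (x i * y j) = x (τ j) * y (σ i) := by
  intro h
  obtain ⟨hinj, -, -, hcol⟩ := hA
  have hsub : ∀ i k : Fin m, i = k := fun i k => by
    have hsymm : x i * y (σ k) = x k * y (σ i) := by
      apply mul_left_cancel₀ (hx0 (τ j₀))
      linear_combination x k * h i j₀ - x i * h k j₀
    have hpair : (i, σ k) = (k, σ i) := hinj hsymm
    exact congrArg Prod.fst hpair
  have hsum := hcol j₀
  rw [Fintype.sum_eq_single i₀ fun k hk => absurd (hsub k i₀) hk] at hsum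
  exact mul_ne_zero (hx0 i₀) (hy0 j₀) hsum

/-- The index sets of a Heffter array are nonempty. -/
theorem IsHeffter.nonempty {F : Type*} [Field F] [Fintype F] {m n : ℕ}
    {A : Matrix (Fin m) (Fin n) F} (hA : IsHeffter A) : Nonempty (Fin m × Fin n) := by
  by_contra h
  rw [not_nonempty_iff] at h
  have hcard := hA.2.1.1
  have hF := Fintype.one_lt_card (α := F)
  simp [Finset.univ_eq_empty] at hcard
  omega

/-- Let `A` be a Heffter array `H(m,n)` over `F` with entries
`a_{i,j} = x_i y_j`, where `X = {x_1,…,x_m}` and `Y = {y_1,…,y_n}` are subsets of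
`Fˣ` of sizes `m` and `n`. Then the group of multipliers of `A` equals the product
`S·T` of the stabilizers of `X` and `Y` under the multiplication action of `Fˣ`. -/
theorem heffter_stmt_7 {F : Type*} [Field F] [Fintype F] {m n : ℕ}
    (x : Fin m → F) (y : Fin n → F)
    (hxinj : Function.Injective x) (hyinj : Function.Injective y)
    (hx0 : ∀ i, x i ≠ 0) (hy0 : ∀ j, y j ≠ 0)
    (hA : IsHeffter (Matrix.of fun i j => x i * y j)) :
    {u : Fˣ | IsMultiplier (Matrix.of fun i j => x i * y j) (u : F)} =
      {u : Fˣ | (fun z => (u : F) * z) '' Set.range x = Set.range x} *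
      {u : Fˣ | (fun z => (u : F) * z) '' Set.range y = Set.range y} := by
  obtain ⟨i₀, j₀⟩ := hA.nonempty
  ext u
  simp only [Set.mem_mul, Set.mem_ofPred_eq, image_mul_range_eq_iff hxinj,
    image_mul_range_eq_iff hyinj, IsMultiplier, Matrix.of_apply]
  constructor
  · rintro ⟨-, ⟨σ, τ, h⟩ | ⟨σ, τ, h⟩⟩
    · let s : Fˣ := Units.mk0 (x (σ i₀)) (hx0 _) / Units.mk0 (x i₀) (hx0 _)
      have hs : (s : F) * x i₀ = x (σ i₀) := by simp [s, hx0]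
      have hy : ∀ j, (u : F) * y j = s * y (τ j) := fun j => by
        apply mul_left_cancel₀ (hx0 i₀)
        linear_combination h i₀ j - y (τ j) * hs
      refine ⟨s, ⟨σ, fun i => ?_⟩, u / s, ⟨τ, fun j => ?_⟩, mul_div_cancel _ _⟩
      · apply mul_right_cancel₀ (hy0 (τ j₀))
        linear_combination h i j₀ - x i * hy j₀
      · apply mul_left_cancel₀ s.ne_zero
        rw [← hy, ← mul_assoc, ← Units.val_mul, mul_div_cancel]
    · exact absurd h (hA.not_transpose_multiplier hx0 hy0 i₀ j₀ σ τ)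
  · rintro ⟨s, ⟨σ, hσ⟩, t, ⟨τ, hτ⟩, rfl⟩
    refine ⟨Units.ne_zero _, Or.inl ⟨σ, τ, fun i j => ?_⟩⟩
    rw [← hσ, ← hτ, Units.val_mul]
    ring
end

section
/- Let A be a rank-one Heffter array H(m,n) over F_q, q = 2mn+1 a prime power, m, n > 2. Then the order of the group of multipliers of A is at most lcm(m_o, n_o), where m_o and n_o denote the greatest odd divisors of m and n, respectively. -/
open scoped Classical Pointwise

/-- A matrix of rank one is the outer product of two vectors. -/
theorem Matrix.exists_eq_mul_of_rank_eq_one {F : Type*} [Field F] {m n : ℕ}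
    {A : Matrix (Fin m) (Fin n) F} (hA : A.rank = 1) :
    ∃ (x : Fin m → F) (y : Fin n → F), ∀ i j, A i j = x i * y j := by
  rw [Matrix.rank_eq_finrank_span_cols, finrank_eq_one_iff'] at hA
  obtain ⟨v, -, hv⟩ := hA
  choose y hy using fun j => hv ⟨A.col j, Submodule.subset_span ⟨j, rfl⟩⟩
  refine ⟨v, y, fun i j => ?_⟩
  have h := congrFun (congrArg Subtype.val (hy j)) i
  simp only [Submodule.coe_smul, Pi.smul_apply, smul_eq_mul, Matrix.col_apply] at h
  rw [← h, mul_comm]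

/-- A half-set contains no two elements that are opposite to each other. -/
theorem IsHalfSet.ne_neg {F : Type*} [Field F] [Fintype F] {L : Finset F} (hL : IsHalfSet L)
    {a b : F} (ha : a ∈ L) (hb : b ∈ L) : a ≠ -b := by
  obtain ⟨hcard, hunion⟩ := hL
  have hneg : (L.image fun z => -z).card = L.card :=
    Finset.card_image_of_injective _ neg_injective
  have hcompl : (Finset.univ \ {0} : Finset F).card = Fintype.card F - 1 := by
    rw [Finset.card_sdiff_of_subset (Finset.subset_univ _), Finset.card_univ,
      Finset.card_singleton]
  have hdisj : Disjoint L (L.image fun z => -z) := by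
    rw [← Finset.card_union_eq_card_add_card, hunion]
    omega
  rintro rfl
  exact Finset.disjoint_left.mp hdisj ha (Finset.mem_image_of_mem _ hb)

theorem IsHeffter.ne_neg {F : Type*} [Field F] [Fintype F] {m n : ℕ}
    {A : Matrix (Fin m) (Fin n) F} (hA : IsHeffter A) (i i' : Fin m) (j j' : Fin n) :
    A i j ≠ -A i' j' :=
  hA.2.1.ne_neg (Finset.mem_image_of_mem _ (Finset.mem_univ (i, j)))
    (Finset.mem_image_of_mem _ (Finset.mem_univ (i', j')))

/-- If multiplication by `a` permutes a family of `m` elements, no two of which are opposite to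
each other, then the order of `a` divides the odd part of `m`. -/
theorem pow_ordCompl_two_eq_one_of_mul_eq_perm {F : Type*} [Field F] {m : ℕ} [NeZero m]
    {x : Fin m → F} (hx : ∀ i j, x i ≠ -x j) {a : F} (σ : Equiv.Perm (Fin m))
    (ha : ∀ i, a * x i = x (σ i)) : a ^ (ordCompl[2] m) = 1 := by
  have hx0 : ∀ i, x i ≠ 0 := fun i h => hx i i (by simp [h])
  have hpow : ∀ (k : ℕ) (i : Fin m), a ^ k * x i = x ((σ ^ k) i) := by
    intro k
    induction k with
    | zero => simp
    | succ k ih => intro i; rw [pow_succ', mul_assoc, ih, ha, pow_succ', Equiv.Perm.mul_apply]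
  have ham : a ^ m = 1 := by
    have hprod : ∏ i, x i ≠ 0 := Finset.prod_ne_zero_iff.mpr fun i _ => hx0 i
    have h : a ^ m * ∏ i, x i = ∏ i, x i := by
      conv_rhs => rw [← Equiv.prod_comp σ x]
      simp [← ha, Finset.prod_mul_distrib]
    exact mul_right_cancel₀ hprod (h.trans (one_mul _).symm)
  refine orderOf_dvd_iff_pow_eq_one.mp
    (Nat.dvd_ordCompl_of_dvd_not_dvd (orderOf_dvd_of_pow_eq_one ham) ?_)
  rintro ⟨k, hk⟩
  have hpos : 0 < orderOf a := orderOf_pos_iff.mpr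
    (isOfFinOrder_iff_pow_eq_one.mpr ⟨m, Nat.pos_of_ne_zero (NeZero.ne m), ham⟩)
  have hsq : (a ^ k) ^ 2 = 1 := by rw [← pow_mul, mul_comm, ← hk, pow_orderOf_eq_one]
  rcases sq_eq_one_iff.mp hsq with h | h
  · have := Nat.le_of_dvd (by omega) (orderOf_dvd_of_pow_eq_one h)
    omega
  · have h0 := hpow k 0
    rw [h, neg_one_mul] at h0
    exact hx _ _ h0.symm

/-- Every multiplier of an outer product is the product of an element stabilizing the left factor
and an element stabilizing the right factor, up to permutations of the entries. -/
theorem IsMultiplier.exists_eq_mul {F : Type*} [Field F] {m n : ℕ} [NeZero m] [NeZero n]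
    {A : Matrix (Fin m) (Fin n) F} {x : Fin m → F} {y : Fin n → F}
    (hA : ∀ i j, A i j = x i * y j) (hx : ∀ i, x i ≠ 0) (hy : ∀ j, y j ≠ 0) {u : F}
    (hu : IsMultiplier A u) :
    ∃ (a b : F) (σ : Equiv.Perm (Fin m)) (τ : Equiv.Perm (Fin n)),
      u = a * b ∧ (∀ i, a * x i = x (σ i)) ∧ ∀ j, b * y j = y (τ j) := by
  have hx0 := hx 0
  have hy0 := hy 0
  obtain ⟨-, ⟨σ, τ, h⟩ | ⟨σ, τ, h⟩⟩ := hu <;> simp only [hA] at h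
  · have hσ := hx (σ 0)
    have hτ := hy (τ 0)
    have hu : u = x (σ 0) / x 0 * (y (τ 0) / y 0) := by
      have := h 0 0
      field_simp
      linear_combination this
    refine ⟨x (σ 0) / x 0, y (τ 0) / y 0, σ, τ, hu, fun i => ?_, fun j => ?_⟩
    · apply mul_right_cancel₀ hτ
      rw [← h i 0, hu]
      field_simp
    · apply mul_left_cancel₀ hσ
      rw [← h 0 j, hu]
      field_simp
  · have hτ := hx (τ 0)
    have hu : u = y (σ 0) / x 0 * (x (τ 0) / y 0) := by
      have := h 0 0
      field_simp
      linear_combination this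
    have hσx : ∀ i, y (σ i) = y (σ 0) / x 0 * x i := by
      intro i
      apply mul_left_cancel₀ hτ
      rw [← h i 0, hu]
      field_simp
    refine ⟨u, 1, σ.trans τ, Equiv.refl _, (mul_one u).symm, fun i => ?_, fun j => one_mul _⟩
    have hσ := hy (σ 0)
    apply mul_right_cancel₀ hσ
    have := h 0 (σ i)
    rw [hσx i] at this
    simp only [Equiv.trans_apply]
    rw [← this]
    field_simp

/-- The group of multipliers of a rank-one Heffter array `H(m,n)` over
`F_q`, `q = 2mn+1`, has order at most `lcm(m_o, n_o)`, where `m_o = ordCompl[2] m`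
and `n_o = ordCompl[2] n` are the odd parts of `m` and `n`. -/
theorem heffter_stmt_8 {F : Type*} [Field F] [Fintype F] (m n : ℕ)
    (hm : 2 < m) (hn : 2 < n) (hq : Fintype.card F = 2 * m * n + 1)
    (A : Matrix (Fin m) (Fin n) F) (hA : IsHeffter A) (hrk : A.rank = 1) :
    {u : F | IsMultiplier A u}.ncard ≤ Nat.lcm (ordCompl[2] m) (ordCompl[2] n) := by
  have : NeZero m := ⟨by omega⟩
  have : NeZero n := ⟨by omega⟩
  obtain ⟨x, y, hxy⟩ := Matrix.exists_eq_mul_of_rank_eq_one hrk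
  have hx : ∀ i i', x i ≠ -x i' := fun i i' h =>
    hA.ne_neg i i' 0 0 (by rw [hxy, hxy, h, neg_mul])
  have hy : ∀ j j', y j ≠ -y j' := fun j j' h =>
    hA.ne_neg 0 0 j j' (by rw [hxy, hxy, h, mul_neg])
  set l := Nat.lcm (ordCompl[2] m) (ordCompl[2] n)
  have hlpos : 0 < l := Nat.lcm_pos (Nat.ordCompl_pos 2 (NeZero.ne m))
    (Nat.ordCompl_pos 2 (NeZero.ne n))
  have hsub : {u : F | IsMultiplier A u} ⊆ ((Polynomial.nthRoots l (1 : F)).toFinset : Set F) := by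
    intro u hu
    obtain ⟨a, b, σ, τ, rfl, ha, hb⟩ := IsMultiplier.exists_eq_mul hxy
      (fun i h => hx i i (by simp [h])) (fun j h => hy j j (by simp [h])) hu
    have ha1 : a ^ l = 1 := orderOf_dvd_iff_pow_eq_one.mp ((orderOf_dvd_of_pow_eq_one
      (pow_ordCompl_two_eq_one_of_mul_eq_perm hx σ ha)).trans (Nat.dvd_lcm_left _ _))
    have hb1 : b ^ l = 1 := orderOf_dvd_iff_pow_eq_one.mp ((orderOf_dvd_of_pow_eq_one
      (pow_ordCompl_two_eq_one_of_mul_eq_perm hy τ hb)).trans (Nat.dvd_lcm_right _ _))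
    simp [Polynomial.mem_nthRoots hlpos, mul_pow, ha1, hb1]
  calc {u : F | IsMultiplier A u}.ncard
      ≤ (Polynomial.nthRoots l (1 : F)).toFinset.card := by
        rw [← Set.ncard_coe_finset]
        exact Set.ncard_le_ncard hsub (Finset.finite_toSet _)
    _ ≤ l := (Multiset.toFinset_card_le _).trans (Polynomial.card_nthRoots l 1)
end

section
/- Let m, n > 2 be integers with q = 2mn+1 a prime power. There exists a rank-one Heffter array H(m,n) over F_q whose group of multipliers has order exactly mn (i.e., a perfect rank-one H(m,n)) if and only if m and n are odd and coprime. Moreover, in that case the group of multipliers is the group C^2 of nonzero squares of F_q. -/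
open scoped Classical Pointwise

theorem Matrix.exists_eq_vecMulVec_of_rank_eq_one {F ι κ : Type*} [Field F] [Finite ι] [Fintype κ]
    {A : Matrix ι κ F} (hA : A.rank = 1) :
    ∃ (x : ι → F) (y : κ → F), A = Matrix.vecMulVec x y := by
  rw [Matrix.rank_eq_finrank_span_cols] at hA
  obtain ⟨v, -, hv⟩ := finrank_eq_one_iff'.1 hA
  have hcol : ∀ j, ∃ c : F, c • (v : ι → F) = A.col j := fun j => by
    obtain ⟨c, hc⟩ := hv ⟨A.col j, Submodule.subset_span ⟨j, rfl⟩⟩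
    exact ⟨c, congrArg Subtype.val hc⟩
  choose y hy using hcol
  refine ⟨v, y, ?_⟩
  ext i j
  have := congrFun (hy j) i
  simp only [Pi.smul_apply, smul_eq_mul, Matrix.col_apply] at this
  rw [Matrix.vecMulVec_apply, ← this, mul_comm]

theorem IsHeffter.apply_ne_zero {F : Type*} [Field F] [Fintype F] {m n : ℕ}
    {A : Matrix (Fin m) (Fin n) F} (hA : IsHeffter A) (i : Fin m) (j : Fin n) : A i j ≠ 0 := by
  have h : A i j ∈ (Finset.univ \ {0} : Finset F) := by
    rw [← hA.2.1.2]
    exact Finset.mem_union_left _ (Finset.mem_image_of_mem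
      (fun p : Fin m × Fin n => A p.1 p.2) (Finset.mem_univ (i, j)))
  simpa using h

theorem IsHeffter.not_isMultiplier_neg_one {F : Type*} [Field F] [Fintype F] {m n : ℕ}
    {A : Matrix (Fin m) (Fin n) F} (hA : IsHeffter A) (hmn : 0 < m * n) :
    ¬ IsMultiplier A (-1) := by
  intro h
  obtain ⟨hinj, ⟨hcard, hunion⟩, -, -⟩ := hA
  have hneg : ∀ i j, ∃ p : Fin m × Fin n, A p.1 p.2 = -A i j := by
    rcases h.2 with ⟨σ, τ, h⟩ | ⟨σ, τ, h⟩
    · exact fun i j => ⟨(σ i, τ j), by rw [← h, neg_one_mul]⟩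
    · exact fun i j => ⟨(τ j, σ i), by rw [← h, neg_one_mul]⟩
  rw [Finset.union_eq_left.2] at hunion
  · have h0 := congrArg Finset.card hunion
    rw [Finset.card_image_of_injective _ hinj] at h0 hcard
    rw [Finset.card_sdiff_of_subset (Finset.subset_univ _), Finset.card_singleton] at h0
    simp only [Finset.card_univ, Fintype.card_prod, Fintype.card_fin] at h0 hcard
    omega
  · intro z hz
    simp only [Finset.mem_image, Finset.mem_univ, true_and] at hz ⊢
    obtain ⟨_, ⟨p, rfl⟩, rfl⟩ := hz
    exact hneg p.1 p.2

theorem IsMultiplier.pow_lcm_eq_one {F : Type*} [Field F] {m n : ℕ} (hm : 0 < m) (hn : 0 < n)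
    {x : Fin m → F} {y : Fin n → F} (hx : ∀ i, x i ≠ 0) (hy : ∀ j, y j ≠ 0) {u : F}
    (hu : IsMultiplier (Matrix.vecMulVec x y) u) : u ^ Nat.lcm m n = 1 := by
  have hX : ∏ i, x i ≠ 0 := Finset.prod_ne_zero_iff.2 fun i _ => hx i
  have hY : ∏ j, y j ≠ 0 := Finset.prod_ne_zero_iff.2 fun j _ => hy j
  obtain ⟨-, ⟨σ, τ, h⟩ | ⟨σ, τ, h⟩⟩ := hu <;> simp only [Matrix.vecMulVec_apply] at h
  · obtain ⟨c, hc⟩ : ∃ c, y (τ ⟨0, hn⟩) = c * y ⟨0, hn⟩ := ⟨_, (div_mul_cancel₀ _ (hy _)).symm⟩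
    have hxσ : ∀ i, u * x i = c * x (σ i) := fun i => by
      refine mul_right_cancel₀ (hy ⟨0, hn⟩) ?_
      rw [mul_assoc, h, hc]
      ring
    have hyτ : ∀ j, y (τ j) = c * y j := fun j => by
      refine mul_left_cancel₀ (hx (σ ⟨0, hm⟩)) ?_
      rw [← h, ← mul_assoc u, hxσ]
      ring
    have hcn : c ^ n = 1 := by
      have := Equiv.prod_comp τ y
      simp only [hyτ, Finset.prod_mul_distrib, Finset.prod_const, Finset.card_univ,
        Fintype.card_fin] at this
      exact mul_right_cancel₀ hY (by rw [this, one_mul])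
    have hum : u ^ m = c ^ m := by
      have := Finset.prod_congr (rfl : (Finset.univ : Finset (Fin m)) = _) fun i _ => hxσ i
      simp only [Finset.prod_mul_distrib, Finset.prod_const, Finset.card_univ,
        Fintype.card_fin, Equiv.prod_comp σ x] at this
      exact mul_right_cancel₀ hX this
    obtain ⟨k, hk⟩ := Nat.dvd_lcm_left m n
    obtain ⟨l, hl⟩ := Nat.dvd_lcm_right m n
    rw [hk, pow_mul, hum, ← pow_mul, ← hk, hl, pow_mul, hcn, one_pow]
  · obtain rfl : m = n := by simpa using Fintype.card_congr σ
    obtain ⟨c, hc⟩ : ∃ c, x (τ ⟨0, hn⟩) = c * y ⟨0, hn⟩ := ⟨_, (div_mul_cancel₀ _ (hy _)).symm⟩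
    have hxσ : ∀ i, u * x i = c * y (σ i) := fun i => by
      refine mul_right_cancel₀ (hy ⟨0, hn⟩) ?_
      rw [mul_assoc, h, hc]
      ring
    have hxτ : ∀ j, x (τ j) = c * y j := fun j => by
      refine mul_right_cancel₀ (hy (σ ⟨0, hm⟩)) ?_
      rw [← h, ← mul_assoc u, hxσ]
      ring
    have hXY : ∏ i, x i = c ^ m * ∏ j, y j := by
      rw [← Equiv.prod_comp τ x]
      simp only [hxτ, Finset.prod_mul_distrib, Finset.prod_const, Finset.card_univ,
        Fintype.card_fin]
    have hum : u ^ m * ∏ i, x i = c ^ m * ∏ j, y j := by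
      have := Finset.prod_congr (rfl : (Finset.univ : Finset (Fin m)) = _) fun i _ => hxσ i
      simpa only [Finset.prod_mul_distrib, Finset.prod_const, Finset.card_univ,
        Fintype.card_fin, Equiv.prod_comp σ y] using this
    rw [Nat.lcm_self]
    exact mul_right_cancel₀ hX (by rw [hum, hXY, one_mul])

theorem ncard_setOf_pow_eq_one_le {F : Type*} [Field F] {k : ℕ} (hk : 0 < k) :
    {u : F | u ^ k = 1}.Finite ∧ {u : F | u ^ k = 1}.ncard ≤ k := by
  have h : {u : F | u ^ k = 1} = ((Polynomial.nthRoots k (1 : F)).toFinset : Set F) := by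
    ext u
    simp [Polynomial.mem_nthRoots hk]
  rw [h, Set.ncard_coe_finset]
  exact ⟨Finset.finite_toSet _,
    (Multiset.toFinset_card_le _).trans (Polynomial.card_nthRoots k 1)⟩

theorem FiniteField.isSquare_iff_pow_eq_one {F : Type*} [Field F] [Fintype F] {k : ℕ}
    (hk : Fintype.card F = 2 * k + 1) {z : F} (hz : z ≠ 0) : IsSquare z ↔ z ^ k = 1 := by
  have hF : ringChar F ≠ 2 := fun h => by
    have := FiniteField.even_card_of_char_two h
    omega
  rw [FiniteField.isSquare_iff hF hz, hk, show (2 * k + 1) / 2 = k by omega]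

/-- A perfect rank-one array forces coprime sides, and its multipliers are the `mn`-th roots of
unity. -/
theorem IsHeffter.coprime_and_setOf_isMultiplier {F : Type*} [Field F] [Fintype F] {m n : ℕ}
    (hm : 0 < m) (hn : 0 < n) {A : Matrix (Fin m) (Fin n) F} (hA : IsHeffter A)
    (hrank : A.rank = 1) (hcard : {u : F | IsMultiplier A u}.ncard = m * n) :
    Nat.Coprime m n ∧ {u : F | IsMultiplier A u} = {u : F | u ^ (m * n) = 1} := by
  obtain ⟨x, y, rfl⟩ := Matrix.exists_eq_vecMulVec_of_rank_eq_one hrank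
  have hx : ∀ i, x i ≠ 0 := fun i => left_ne_zero_of_mul (hA.apply_ne_zero i ⟨0, hn⟩)
  have hy : ∀ j, y j ≠ 0 := fun j => right_ne_zero_of_mul (hA.apply_ne_zero ⟨0, hm⟩ j)
  have hsub : {u : F | IsMultiplier (Matrix.vecMulVec x y) u} ⊆ {u : F | u ^ Nat.lcm m n = 1} :=
    fun u hu => IsMultiplier.pow_lcm_eq_one hm hn hx hy hu
  obtain ⟨hfin, hle⟩ := ncard_setOf_pow_eq_one_le (F := F) (Nat.lcm_pos hm hn)
  have hcop : Nat.Coprime m n := by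
    have h1 : m * n ≤ Nat.lcm m n := hcard ▸ (Set.ncard_le_ncard hsub hfin).trans hle
    have h2 := Nat.gcd_mul_lcm m n
    have h3 : 0 < Nat.gcd m n := Nat.gcd_pos_of_pos_left _ hm
    have h4 := Nat.mul_pos hm hn
    rw [Nat.coprime_iff_gcd_eq_one]
    nlinarith
  rw [hcop.lcm_eq_mul] at hsub hfin hle
  exact ⟨hcop, Set.eq_of_subset_of_ncard_le hsub (hle.trans hcard.ge) hfin⟩

theorem IsPrimitiveRoot.pow_val_add {F : Type*} [Field F] {k : ℕ} [NeZero k] {ζ : F}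
    (hζ : IsPrimitiveRoot ζ k) (i j : Fin k) :
    ζ ^ (i + j : Fin k).val = ζ ^ i.val * ζ ^ j.val := by
  rw [Fin.val_add, ← pow_add, pow_eq_pow_mod (i.val + j.val) hζ.pow_eq_one]

theorem IsPrimitiveRoot.injective_pow_mul_pow {F : Type*} [Field F] {m n : ℕ}
    (hmn : Nat.Coprime m n) {α β : F} (hα : IsPrimitiveRoot α m) (hβ : IsPrimitiveRoot β n) :
    Function.Injective (fun p : Fin m × Fin n => α ^ p.1.val * β ^ p.2.val) := by
  rintro ⟨i, j⟩ ⟨i', j'⟩ h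
  simp only at h
  have hi : i.val = i'.val := by
    have h' := congrArg (· ^ n) h
    simp only [mul_pow, ← pow_mul, mul_comm _ n] at h'
    simp only [pow_mul, hβ.pow_eq_one, one_pow, mul_one] at h'
    exact (hα.pow_of_coprime n hmn.symm).pow_inj i.2 i'.2 h'
  have hj : j.val = j'.val := by
    have h' := congrArg (· ^ m) h
    simp only [mul_pow, ← pow_mul, mul_comm _ m] at h'
    simp only [pow_mul, hα.pow_eq_one, one_pow, one_mul] at h'
    exact (hβ.pow_of_coprime m hmn).pow_inj j.2 j'.2 h'
  exact Prod.ext (Fin.ext hi) (Fin.ext hj)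

/-- Products of the powers of primitive roots of coprime odd orders form a perfect rank-one
Heffter array. -/
theorem exists_perfect_rank_one_heffter {F : Type*} [Field F] [Fintype F] {m n : ℕ}
    (hm : 1 < m) (hn : 1 < n) (hq : Fintype.card F = 2 * m * n + 1)
    (hm_odd : Odd m) (hn_odd : Odd n) (hmn : Nat.Coprime m n) :
    ∃ A : Matrix (Fin m) (Fin n) F, IsHeffter A ∧ A.rank = 1 ∧
      {u : F | IsMultiplier A u}.ncard = m * n := by
  have : NeZero m := ⟨by omega⟩
  have : NeZero n := ⟨by omega⟩
  have hpos : 0 < m * n := by positivity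
  obtain ⟨g, hg⟩ := IsCyclic.exists_generator (α := Fˣ)
  have hgF : IsPrimitiveRoot (g : F) (2 * m * n) := by
    rw [IsPrimitiveRoot.coe_units_iff]
    have := IsPrimitiveRoot.orderOf g
    rwa [orderOf_eq_card_of_forall_mem_zpowers hg, Nat.card_eq_fintype_card, Fintype.card_units,
      hq, Nat.add_sub_cancel] at this
  obtain ⟨α, hα⟩ : ∃ α : F, IsPrimitiveRoot α m :=
    ⟨_, hgF.pow (by positivity) (show 2 * m * n = 2 * n * m by ring)⟩
  obtain ⟨β, hβ⟩ : ∃ β : F, IsPrimitiveRoot β n := ⟨_, hgF.pow (by positivity) rfl⟩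
  have hinj := IsPrimitiveRoot.injective_pow_mul_pow hmn hα hβ
  have hrange : Set.range (fun p : Fin m × Fin n => α ^ p.1.val * β ^ p.2.val) =
      {z : F | z ^ (m * n) = 1} := by
    obtain ⟨hfin, hle⟩ := ncard_setOf_pow_eq_one_le (F := F) hpos
    refine Set.eq_of_subset_of_ncard_le ?_ ?_ hfin
    · rintro _ ⟨p, rfl⟩
      have h1 : (α ^ p.1.val) ^ (m * n) = 1 := by
        rw [pow_mul, pow_right_comm α, hα.pow_eq_one, one_pow, one_pow]
      have h2 : (β ^ p.2.val) ^ (m * n) = 1 := by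
        rw [mul_comm m n, pow_mul, pow_right_comm β, hβ.pow_eq_one, one_pow, one_pow]
      exact (mul_pow _ _ _).trans (by rw [h1, h2, one_mul])
    · refine hle.trans (Eq.ge ?_)
      rw [← Set.image_univ, Set.ncard_image_of_injective _ hinj, Set.ncard_univ]
      simp
  have hmem : ∀ z : F, (∃ p : Fin m × Fin n, α ^ p.1.val * β ^ p.2.val = z) ↔ z ^ (m * n) = 1 :=
    fun z => Set.ext_iff.1 hrange z
  have hmult : {u : F | IsMultiplier (Matrix.of fun (i : Fin m) (j : Fin n) =>
      α ^ i.val * β ^ j.val) u} = Set.range fun p : Fin m × Fin n => α ^ p.1.val * β ^ p.2.val := by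
    ext u
    constructor
    · rintro ⟨-, ⟨σ, τ, h⟩ | ⟨σ, τ, h⟩⟩
      · exact ⟨(σ 0, τ 0), by simpa using (h 0 0).symm⟩
      · exact ⟨(τ 0, σ 0), by simpa using (h 0 0).symm⟩
    · rintro ⟨p, rfl⟩
      refine ⟨mul_ne_zero (pow_ne_zero _ (hα.ne_zero (by omega)))
        (pow_ne_zero _ (hβ.ne_zero (by omega))), Or.inl
        ⟨Equiv.addLeft p.1, Equiv.addLeft p.2, fun i j => ?_⟩⟩
      simp only [Matrix.of_apply, Equiv.coe_addLeft, hα.pow_val_add, hβ.pow_val_add]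
      ring
  refine ⟨Matrix.of fun i j => α ^ i.val * β ^ j.val,
    ⟨hinj, ⟨?_, ?_⟩, fun i => ?_, fun j => ?_⟩, ?_, ?_⟩
  · simp only [Matrix.of_apply]
    rw [Finset.card_image_of_injective _ hinj, hq]
    simp [mul_assoc]
  · ext z
    simp only [Matrix.of_apply, Finset.mem_union, Finset.mem_image, Finset.mem_univ, true_and,
      Finset.mem_sdiff, Finset.mem_singleton, hmem]
    constructor
    · have hne : ∀ w : F, w ^ (m * n) = 1 → w ≠ 0 := by
        rintro _ h rfl
        rw [zero_pow hpos.ne'] at h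
        exact zero_ne_one h
      rintro (h | ⟨w, h, rfl⟩)
      · exact hne z h
      · exact neg_ne_zero.2 (hne w h)
    · intro hz
      have hz2 := FiniteField.pow_card_sub_one_eq_one z hz
      rw [hq, Nat.add_sub_cancel, mul_assoc, mul_comm 2, pow_mul] at hz2
      rcases mul_self_eq_one_iff.1 ((sq _).symm.trans hz2) with h | h
      · exact Or.inl h
      · exact Or.inr ⟨-z, by rw [(hm_odd.mul hn_odd).neg_pow, h, neg_neg], neg_neg z⟩
  · simp only [Matrix.of_apply]
    rw [← Finset.mul_sum, Fin.sum_univ_eq_sum_range (fun j => β ^ j), hβ.geom_sum_eq_zero hn,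
      mul_zero]
  · simp only [Matrix.of_apply]
    rw [← Finset.sum_mul, Fin.sum_univ_eq_sum_range (fun j => α ^ j), hα.geom_sum_eq_zero hm,
      zero_mul]
  · refine le_antisymm (Matrix.rank_vecMulVec_le (fun i : Fin m => α ^ i.val)
      (fun j : Fin n => β ^ j.val)) (Nat.one_le_iff_ne_zero.2 fun h => ?_)
    rw [Matrix.rank_eq_finrank_span_cols, Submodule.finrank_eq_zero, Submodule.span_eq_bot] at h
    simpa using congrFun (h _ ⟨0, rfl⟩) 0
  · rw [hmult, ← Set.image_univ, Set.ncard_image_of_injective _ hinj, Set.ncard_univ]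
    simp

/-- For `m, n > 2` with `q = 2mn + 1` a prime power, there exists a
perfect rank-one Heffter array `H(m,n)` over `F_q` (one whose group of multipliers
has order exactly `mn`) iff `m` and `n` are odd and coprime; moreover, in that case
the group of multipliers is the group `C²` of nonzero squares of `F_q`. -/
theorem heffter_stmt_10 {F : Type*} [Field F] [Fintype F] (m n : ℕ)
    (hm : 2 < m) (hn : 2 < n) (hq : Fintype.card F = 2 * m * n + 1) :
    ((∃ A : Matrix (Fin m) (Fin n) F, IsHeffter A ∧ A.rank = 1 ∧
        {u : F | IsMultiplier A u}.ncard = m * n) ↔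
      (Odd m ∧ Odd n ∧ Nat.Coprime m n)) ∧
    (∀ A : Matrix (Fin m) (Fin n) F, IsHeffter A → A.rank = 1 →
      {u : F | IsMultiplier A u}.ncard = m * n →
      {u : F | IsMultiplier A u} = {z : F | z ≠ 0 ∧ IsSquare z}) := by
  have hq' : Fintype.card F = 2 * (m * n) + 1 := by rw [hq, mul_assoc]
  have hpos : 0 < m * n := by positivity
  refine ⟨⟨?_, fun ⟨hm_odd, hn_odd, hmn⟩ => exists_perfect_rank_one_heffter (by omega) (by omega)
    hq hm_odd hn_odd hmn⟩, fun A hA hrank hcard => ?_⟩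
  · rintro ⟨A, hA, hrank, hcard⟩
    obtain ⟨hcop, hset⟩ := hA.coprime_and_setOf_isMultiplier (by omega) (by omega) hrank hcard
    have hodd : Odd (m * n) := by
      by_contra heven
      refine hA.not_isMultiplier_neg_one hpos ?_
      have : (-1 : F) ∈ {u : F | u ^ (m * n) = 1} := (Nat.not_odd_iff_even.1 heven).neg_one_pow
      rwa [← hset] at this
    exact ⟨(Nat.odd_mul.1 hodd).1, (Nat.odd_mul.1 hodd).2, hcop⟩
  · rw [(hA.coprime_and_setOf_isMultiplier (by omega) (by omega) hrank hcard).2]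
    ext z
    constructor
    · intro hz
      have hz0 : z ≠ 0 := by
        rintro rfl
        simp [zero_pow hpos.ne'] at hz
      exact ⟨hz0, (FiniteField.isSquare_iff_pow_eq_one hq' hz0).2 hz⟩
    · rintro ⟨hz0, hz⟩
      exact (FiniteField.isSquare_iff_pow_eq_one hq' hz0).1 hz
end

section
/- Let A = (a_{i,j}) be a rank-one Heffter array H(m,n) over F_q, q = 2mn+1 a prime power. If the partial sums a_{1,1}, a_{1,1}+a_{1,2}, …, a_{1,1}+…+a_{1,n} of the first row are pairwise distinct and the partial sums a_{1,1}, a_{1,1}+a_{2,1}, …, a_{1,1}+…+a_{m,1} of the first column are pairwise distinct, then A is globally simple, i.e., for every row i the partial sums ∑_{k=1}^{j} a_{i,k} (1 ≤ j ≤ n) are pairwise distinct, and for every column j the partial sums ∑_{k=1}^{i} a_{k,j} (1 ≤ i ≤ m) are pairwise distinct. -/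
open scoped Classical Pointwise

/-- A matrix of rank at most one over a field is an outer product. -/
theorem Matrix.exists_eq_mul_of_rank_le_one {K ι κ : Type*} [Field K] [Finite ι] [Fintype κ]
    (A : Matrix ι κ K) (h : A.rank ≤ 1) :
    ∃ (v : ι → K) (w : κ → K), ∀ i j, A i j = v i * w j := by
  rw [Matrix.rank_eq_finrank_span_cols, finrank_le_one_iff] at h
  obtain ⟨v, hv⟩ := h
  choose w hw using fun j => hv ⟨A.col j, Submodule.subset_span ⟨j, rfl⟩⟩
  refine ⟨v, w, fun i j => ?_⟩
  have := congrFun (congrArg Subtype.val (hw j)) i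
  simpa [mul_comm] using this.symm

/-- Partial sums of `c • w` are pairwise distinct once those of some multiple `b • w` are. -/
theorem injective_partialSum_const_mul {K ι : Type*} [Field K] [Preorder ι]
    [LocallyFiniteOrderBot ι] {w : ι → K} {b c : K} (hc : c ≠ 0)
    (h : Function.Injective fun j => ∑ k ∈ Finset.Iic j, b * w k) :
    Function.Injective fun j => ∑ k ∈ Finset.Iic j, c * w k := by
  simp only [← Finset.mul_sum] at h ⊢
  intro x y hxy
  exact h (congrArg (b * ·) (mul_left_cancel₀ hc hxy))

/-- If the partial sums of the first row and of the first column of a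
rank-one Heffter array `H(m,n)` over `F_q` are pairwise distinct, then the array is
globally simple: every row and every column has pairwise distinct partial sums. -/
theorem heffter_stmt_11 {F : Type*} [Field F] [Fintype F] (m n : ℕ)
    (hm : 0 < m) (hn : 0 < n)
    (A : Matrix (Fin m) (Fin n) F) (hA : IsHeffter A) (hrk : A.rank = 1)
    (hrow : Function.Injective (fun j : Fin n => ∑ k ∈ Finset.Iic j, A ⟨0, hm⟩ k))
    (hcol : Function.Injective (fun i : Fin m => ∑ k ∈ Finset.Iic i, A k ⟨0, hn⟩)) :
    (∀ i : Fin m, Function.Injective (fun j : Fin n => ∑ k ∈ Finset.Iic j, A i k)) ∧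
    (∀ j : Fin n, Function.Injective (fun i : Fin m => ∑ k ∈ Finset.Iic i, A k j)) := by
  obtain ⟨v, w, hvw⟩ := A.exists_eq_mul_of_rank_le_one hrk.le
  have hne := hA.apply_ne_zero
  simp only [hvw] at hrow hcol hne ⊢
  refine ⟨fun i => injective_partialSum_const_mul (left_ne_zero_of_mul (hne i ⟨0, hn⟩)) hrow,
    fun j => ?_⟩
  simp only [mul_comm (v _)] at hcol ⊢
  exact injective_partialSum_const_mul (right_ne_zero_of_mul (hne ⟨0, hm⟩ j)) hcol
end

section
/- If q = 2mn + 1 is a prime power with m, n > 2 odd and coprime, then there exists a globally simple Heffter array H(m,n) over F_q. -/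
open scoped Classical Pointwise

/-- The partial sums of a geometric progression of ratio `b`, taken up to an index below the
order of `b`, are pairwise distinct. -/
lemma injective_geom_partialSum {F : Type*} [Field F] {n : ℕ} (hn : 1 < n) {a b : F}
    (ha : a ≠ 0) (hb : orderOf b = n) :
    Function.Injective (fun j : Fin n => ∑ k ∈ Finset.Iic j, a * b ^ (k : ℕ)) := by
  have hb1 : b ≠ 1 := by
    rintro rfl
    rw [orderOf_one] at hb
    omega
  have hb0 : b ≠ 0 := by
    rintro rfl
    rw [orderOf_zero] at hb
    omega
  have hsum (j : Fin n) :
      ∑ k ∈ Finset.Iic j, a * b ^ (k : ℕ) = a * ((b ^ (j : ℕ) * b - 1) / (b - 1)) := by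
    rw [← Finset.mul_sum, ← pow_succ, ← geom_sum_eq hb1, Nat.range_succ_eq_Iic,
      ← Fin.map_valEmbedding_Iic, Finset.sum_map]
    rfl
  intro i j hij
  simp only [hsum] at hij
  have hpow : b ^ (i : ℕ) = b ^ (j : ℕ) := by
    have h := mul_left_cancel₀ ha hij
    rw [div_left_inj' (sub_ne_zero.mpr hb1), sub_left_inj] at h
    exact mul_right_cancel₀ hb0 h
  exact Fin.ext (pow_injOn_Iio_orderOf (by simp [hb]) (by simp [hb]) hpow)

/-- A full period of a geometric progression of ratio `b ≠ 1` sums to zero. -/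
lemma sum_geom_orderOf_eq_zero {F : Type*} [Field F] {n : ℕ} (hn : 1 < n) (a : F) {b : F}
    (hb : orderOf b = n) : ∑ j : Fin n, a * b ^ (j : ℕ) = 0 := by
  have hb1 : b ≠ 1 := by
    rintro rfl
    rw [orderOf_one] at hb
    omega
  rw [← Finset.mul_sum, Fin.sum_univ_eq_sum_range (fun k => b ^ k) n, geom_sum_eq hb1, ← hb,
    pow_orderOf_eq_one, sub_self, zero_div, mul_zero]

/-- If `a` and `b` have coprime orders `m` and `n`, the products `a ^ i * b ^ j` with `i < m` and
`j < n` are pairwise distinct. -/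
lemma injective_pow_mul_pow {F : Type*} [Field F] {m n : ℕ} (hm : 0 < m) (hn : 0 < n)
    (hmn : Nat.Coprime m n) {a b : F} (ha : orderOf a = m) (hb : orderOf b = n) :
    Function.Injective (fun p : Fin m × Fin n => a ^ (p.1 : ℕ) * b ^ (p.2 : ℕ)) := by
  have hbn : b ^ n = 1 := hb ▸ pow_orderOf_eq_one b
  have hb0 : b ≠ 0 := by
    rintro rfl
    simp [hn.ne'] at hbn
  have ha0 : a ≠ 0 := by
    rintro rfl
    rw [orderOf_zero] at ha
    omega
  have han : orderOf (a ^ n) = m := by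
    rw [Nat.Coprime.orderOf_pow (by rwa [ha]), ha]
  rintro ⟨i, j⟩ ⟨k, l⟩ h
  dsimp only at h
  have hpow : (a ^ n) ^ (i : ℕ) = (a ^ n) ^ (k : ℕ) := by
    have h' := congrArg (· ^ n) h
    simpa only [mul_pow, pow_right_comm _ _ n, hbn, one_pow, mul_one] using h'
  obtain rfl : i = k :=
    Fin.ext (pow_injOn_Iio_orderOf (by simp [han]) (by simp [han]) hpow)
  have h' := mul_left_cancel₀ (pow_ne_zero _ ha0) h
  obtain rfl : j = l :=
    Fin.ext (pow_injOn_Iio_orderOf (by simp [hb]) (by simp [hb]) h')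
  rfl

/-- In a finite field of order `2ℓ + 1` with `ℓ` odd, a set of `ℓ` distinct `ℓ`-th roots of unity
is a half-set. -/
lemma isHalfSet_of_pow_eq_one {F : Type*} [Field F] [Fintype F] {l : ℕ} (hl : Odd l)
    (hq : Fintype.card F = 2 * l + 1) (L : Finset F) (hcard : L.card = l)
    (hL : ∀ x ∈ L, x ^ l = 1) : IsHalfSet L := by
  have hneg : (1 : F) ≠ -1 := by
    intro h
    have h2 : (2 : F) = 0 := by linear_combination h
    have hc := FiniteField.cast_card_eq_zero F
    rw [hq] at hc
    push_cast at hc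
    rw [h2, zero_mul, zero_add] at hc
    exact one_ne_zero hc
  have hdisj : Disjoint L (L.image fun z => -z) := by
    rw [Finset.disjoint_left]
    intro x hx hx'
    obtain ⟨y, hy, rfl⟩ := Finset.mem_image.mp hx'
    have h := hL _ hx
    rw [hl.neg_pow, hL y hy] at h
    exact hneg h.symm
  have h0 : (0 : F) ∉ L := fun h => by simpa [hl.pos.ne'] using hL 0 h
  refine ⟨by rw [hcard, hq], Finset.eq_of_subset_of_card_le ?_ ?_⟩
  · intro x hx
    have hx0 : x ≠ 0 := by
      rintro rfl
      simp [h0] at hx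
    simp [hx0]
  · rw [Finset.card_union_of_disjoint hdisj, Finset.card_image_of_injective _ neg_injective,
      ← Finset.compl_eq_univ_sdiff, Finset.card_compl, Finset.card_singleton, hq, hcard]
    omega

/-- A finite field has an element of each multiplicative order dividing `q - 1`. -/
lemma exists_orderOf_eq_of_dvd_card_sub_one {F : Type*} [Field F] [Fintype F] {d : ℕ}
    (hd : d ∣ Fintype.card F - 1) : ∃ a : F, orderOf a = d := by
  obtain ⟨g, hg⟩ := IsCyclic.exists_ofOrder_eq_natCard (α := Fˣ)
  rw [Nat.card_eq_fintype_card, Fintype.card_units] at hg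
  obtain ⟨c, hc⟩ := hd
  have hpos : 0 < Fintype.card F - 1 := Nat.sub_pos_of_lt Fintype.one_lt_card
  have hc0 : c ≠ 0 := by
    rintro rfl
    omega
  refine ⟨((g ^ c : Fˣ) : F), ?_⟩
  rw [orderOf_units, orderOf_pow_of_dvd hc0 (by rw [hg, hc]; exact dvd_mul_left c d), hg, hc,
    Nat.mul_div_cancel _ (Nat.pos_of_ne_zero hc0)]

/-- If `q = 2mn + 1` is a prime power with `m, n > 2` odd and coprime,
then there exists a globally simple Heffter array `H(m,n)` over `F_q` (all rows and
all columns have pairwise distinct partial sums). -/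
theorem heffter_stmt_13 {F : Type*} [Field F] [Fintype F] (m n : ℕ)
    (hm : 2 < m) (hn : 2 < n) (hmo : Odd m) (hno : Odd n) (hmn : Nat.Coprime m n)
    (hq : Fintype.card F = 2 * m * n + 1) :
    ∃ A : Matrix (Fin m) (Fin n) F, IsHeffter A ∧
      (∀ i : Fin m, Function.Injective (fun j : Fin n => ∑ k ∈ Finset.Iic j, A i k)) ∧
      (∀ j : Fin n, Function.Injective (fun i : Fin m => ∑ k ∈ Finset.Iic i, A k j)) := by
  obtain ⟨a, ha⟩ := exists_orderOf_eq_of_dvd_card_sub_one (F := F) (d := m)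
    ⟨2 * n, by rw [hq, Nat.add_sub_cancel]; ring⟩
  obtain ⟨b, hb⟩ := exists_orderOf_eq_of_dvd_card_sub_one (F := F) (d := n)
    ⟨2 * m, by rw [hq, Nat.add_sub_cancel]; ring⟩
  have ham : a ^ m = 1 := ha ▸ pow_orderOf_eq_one a
  have hbn : b ^ n = 1 := hb ▸ pow_orderOf_eq_one b
  have ha0 : a ≠ 0 := by
    rintro rfl
    rw [orderOf_zero] at ha
    omega
  have hb0 : b ≠ 0 := by
    rintro rfl
    rw [orderOf_zero] at hb
    omega
  have hinj := injective_pow_mul_pow (by omega) (by omega) hmn ha hb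
  refine ⟨fun i j => a ^ (i : ℕ) * b ^ (j : ℕ), ⟨hinj, ?_, ?_, ?_⟩, ?_, ?_⟩
  · refine isHalfSet_of_pow_eq_one (hmo.mul hno) (by rw [hq, mul_assoc]) _ ?_ ?_
    · rw [Finset.card_image_of_injective _ hinj]
      simp
    · intro x hx
      obtain ⟨p, -, rfl⟩ := Finset.mem_image.mp hx
      rw [mul_pow, pow_right_comm, pow_mul a, ham, pow_right_comm b, mul_comm m n, pow_mul b, hbn]
      simp
  · exact fun i => sum_geom_orderOf_eq_zero (by omega) _ hb
  · intro j
    simp only [mul_comm (a ^ _)]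
    exact sum_geom_orderOf_eq_zero (by omega) _ ha
  · exact fun i => injective_geom_partialSum (by omega) (pow_ne_zero _ ha0) hb
  · intro j
    simp only [mul_comm (a ^ _)]
    exact injective_geom_partialSum (by omega) (pow_ne_zero _ hb0) ha
end

section
/- Let q = 2mn + 1 be a prime power with m, n > 2, and suppose there exist distinct odd primes p and p' with p dividing m and p' dividing n (i.e., the pair (m,n) is agreeable). Then there exists a rank-one Heffter array H(m,n) over F_q. -/
open scoped Classical Pointwise

/-- An outer product of two zero-sum vectors whose entries have pairwise distinct nonzero squares
is a rank-one Heffter array. -/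
theorem isHeffter_vecMulVec {F : Type*} [Field F] [Fintype F] {m n : ℕ} (hm : 0 < m) (hn : 0 < n)
    (hq : Fintype.card F = 2 * m * n + 1) (x : Fin m → F) (y : Fin n → F)
    (hx : ∀ i, x i ≠ 0) (hy : ∀ j, y j ≠ 0) (hxs : ∑ i, x i = 0) (hys : ∑ j, y j = 0)
    (hinj : ∀ i j i' j', (x i * y j) ^ 2 = (x i' * y j') ^ 2 → i = i' ∧ j = j') :
    IsHeffter (Matrix.vecMulVec x y) ∧ (Matrix.vecMulVec x y).rank = 1 := by
  have htwo : (2 : F) ≠ 0 := by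
    refine Ring.two_ne_zero fun h => ?_
    have := FiniteField.even_card_of_char_two h
    rw [hq, mul_assoc] at this
    omega
  have hA : Function.Injective (fun p : Fin m × Fin n => Matrix.vecMulVec x y p.1 p.2) := by
    rintro ⟨i, j⟩ ⟨i', j'⟩ h
    have := hinj i j i' j' (congrArg (· ^ 2) h)
    exact Prod.ext this.1 this.2
  refine ⟨⟨hA, ?_, fun i => ?_, fun j => ?_⟩, ?_⟩
  · have hcard : (Finset.image (fun p : Fin m × Fin n => Matrix.vecMulVec x y p.1 p.2)
        Finset.univ).card = m * n := by
      rw [Finset.card_image_of_injective _ hA]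
      simp
    refine ⟨by rw [hcard, hq, mul_assoc], Finset.eq_of_subset_of_card_le ?_ ?_⟩
    · intro z hz
      simp only [Finset.mem_union, Finset.mem_image, Finset.mem_univ, true_and, Prod.exists,
        Matrix.vecMulVec_apply] at hz
      rw [Finset.mem_sdiff, Finset.mem_singleton]
      refine ⟨Finset.mem_univ _, ?_⟩
      rcases hz with ⟨i, j, rfl⟩ | ⟨_, ⟨i, j, rfl⟩, rfl⟩
      · exact mul_ne_zero (hx i) (hy j)
      · exact neg_ne_zero.mpr (mul_ne_zero (hx i) (hy j))
    · rw [Finset.card_union_of_disjoint, Finset.card_image_of_injective _ neg_injective, hcard,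
        Finset.card_sdiff_of_subset (Finset.subset_univ _), Finset.card_univ, hq,
        Finset.card_singleton, mul_assoc]
      · omega
      · rw [Finset.disjoint_left]
        intro z hz hz'
        simp only [Finset.mem_image, Finset.mem_univ, true_and, Prod.exists,
          Matrix.vecMulVec_apply] at hz hz'
        obtain ⟨i, j, rfl⟩ := hz
        obtain ⟨_, ⟨i', j', rfl⟩, h⟩ := hz'
        obtain ⟨rfl, rfl⟩ := hinj i' j' i j (by rw [← h, neg_sq])
        have : 2 * (x i' * y j') = 0 := by linear_combination -h
        exact mul_ne_zero htwo (mul_ne_zero (hx _) (hy _)) this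
  · simp only [Matrix.vecMulVec_apply, ← Finset.mul_sum, hys, mul_zero]
  · simp only [Matrix.vecMulVec_apply, ← Finset.sum_mul, hxs, zero_mul]
  · refine le_antisymm (Matrix.rank_vecMulVec_le _ _) (Nat.one_le_iff_ne_zero.mpr fun h => ?_)
    rw [Matrix.rank, Submodule.finrank_eq_zero, LinearMap.range_eq_bot, ← Matrix.toLin'_apply',
      LinearEquiv.map_eq_zero_iff] at h
    have h0 := congrFun (congrFun h ⟨0, hm⟩) ⟨0, hn⟩
    exact mul_ne_zero (hx _) (hy _) h0

/-- The mixed-radix expansion modulo `a * b * p * r`, with `p` and `r` coprime and the two leading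
digits combined by the Chinese remainder theorem, is unique. -/
theorem mixed_radix_unique {a b p r i j s t i' j' s' t' : ℕ} (hpr : Nat.Coprime p r)
    (hp : Odd p) (hr : Odd r) (hi : i < a) (hi' : i' < a) (hj : j < b) (hj' : j' < b)
    (hs : s < p) (hs' : s' < p) (ht : t < r) (ht' : t' < r)
    (h : i + a * j + a * b * (2 * (r * s + p * t)) ≡
      i' + a * j' + a * b * (2 * (r * s' + p * t')) [MOD a * b * (p * r)]) :
    (i = i' ∧ s = s') ∧ (j = j' ∧ t = t') := by
  have hlt : ∀ {i j : ℕ}, i < a → j < b → i + a * j < a * b := fun {i j} hi hj => by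
    nlinarith [Nat.mul_le_mul_left a (Nat.succ_le_of_lt hj)]
  have hlow : i + a * j = i' + a * j' := by
    have := h.of_mul_right (p * r)
    simp only [Nat.ModEq, Nat.add_mul_mod_self_left] at this
    rwa [Nat.mod_eq_of_lt (hlt hi hj), Nat.mod_eq_of_lt (hlt hi' hj')] at this
  have ha : 0 < a := by omega
  have hb : 0 < b := by omega
  have hii : i = i' := by
    have := congrArg (· % a) hlow
    simpa [Nat.add_mul_mod_self_left, Nat.mod_eq_of_lt hi, Nat.mod_eq_of_lt hi'] using this
  subst hii
  have hjj : j = j' := Nat.eq_of_mul_eq_mul_left ha (Nat.add_left_cancel hlow)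
  subst hjj
  have h1 := Nat.ModEq.mul_left_cancel' (Nat.mul_pos ha hb).ne' (Nat.ModEq.add_left_cancel' _ h)
  have h2 : r * s + p * t ≡ r * s' + p * t' [MOD p * r] :=
    h1.cancel_left_of_coprime ((hp.mul hr).coprime_two_right)
  refine ⟨⟨rfl, ?_⟩, rfl, ?_⟩
  · have h3 := h2.of_mul_right r
    simp only [Nat.ModEq, Nat.add_mul_mod_self_left] at h3
    exact (Nat.ModEq.cancel_left_of_coprime hpr h3).eq_of_lt_of_lt hs hs'
  · have h3 := h2.of_mul_left p
    rw [add_comm, add_comm (r * s')] at h3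
    simp only [Nat.ModEq, Nat.add_mul_mod_self_left] at h3
    exact (Nat.ModEq.cancel_left_of_coprime hpr.symm h3).eq_of_lt_of_lt ht ht'

/-- A union of cosets of the group of `p`-th roots of unity has sum zero. -/
theorem sum_mul_pow_eq_zero {F : Type*} [Field F] {p a : ℕ} {ζ : F} (hζ : IsPrimitiveRoot ζ p)
    (hp : 1 < p) (f : Fin a → F) :
    ∑ k : Fin (p * a), f (finProdFinEquiv.symm k).2 * ζ ^ ((finProdFinEquiv.symm k).1 : ℕ) = 0 := by
  rw [finProdFinEquiv.symm.sum_comp (fun q : Fin p × Fin a => f q.2 * ζ ^ (q.1 : ℕ)),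
    Fintype.sum_prod_type_right]
  refine Finset.sum_eq_zero fun i _ => ?_
  dsimp only
  rw [← Finset.mul_sum, Fin.sum_univ_eq_sum_range (fun s => ζ ^ s), hζ.geom_sum_eq_zero hp,
    mul_zero]

/-- If `q = 2mn + 1` is a prime power with `m, n > 2` and the pair
`(m,n)` is agreeable (there are distinct odd primes `p ∣ m` and `p' ∣ n`), then
there exists a rank-one Heffter array `H(m,n)` over `F_q`. -/
theorem heffter_stmt_14 {F : Type*} [Field F] [Fintype F] (m n : ℕ)
    (hm : 2 < m) (hn : 2 < n) (hq : Fintype.card F = 2 * m * n + 1)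
    (hagree : ∃ p p' : ℕ, p.Prime ∧ p'.Prime ∧ Odd p ∧ Odd p' ∧ p ≠ p' ∧ p ∣ m ∧ p' ∣ n) :
    ∃ A : Matrix (Fin m) (Fin n) F, IsHeffter A ∧ A.rank = 1 := by
  obtain ⟨p, r, hp, hr, hpo, hro, hne, ⟨a, rfl⟩, ⟨b, rfl⟩⟩ := hagree
  obtain ⟨g, hg⟩ : ∃ g : F, IsPrimitiveRoot g (2 * (a * b * (p * r))) := by
    obtain ⟨u, hu⟩ := IsCyclic.exists_generator (α := Fˣ)
    refine ⟨u, ?_⟩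
    have hcard : orderOf u = 2 * (a * b * (p * r)) := by
      rw [orderOf_eq_card_of_forall_mem_zpowers hu, Nat.card_units, Nat.card_eq_fintype_card, hq,
        Nat.add_sub_cancel]
      ring
    rw [← hcard, ← orderOf_units]
    exact IsPrimitiveRoot.orderOf _
  have hpos : 0 < 2 * (a * b * (p * r)) := by
    have := Nat.mul_pos (by omega : 0 < p * a) (by omega : 0 < r * b)
    nlinarith
  have hg0 : g ≠ 0 := hg.ne_zero hpos.ne'
  have hsq : IsPrimitiveRoot (g ^ 2) (a * b * (p * r)) := hg.pow hpos rfl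
  have hζ : IsPrimitiveRoot (g ^ (a * b * (2 * r))) p := hg.pow hpos (by ring)
  have hξ : IsPrimitiveRoot (g ^ (a * b * (2 * p))) r := hg.pow hpos (by ring)
  refine ⟨_, isHeffter_vecMulVec (by omega) (by omega) hq
    (fun k => g ^ ((finProdFinEquiv.symm k).2 : ℕ) *
      (g ^ (a * b * (2 * r))) ^ ((finProdFinEquiv.symm k).1 : ℕ))
    (fun k => g ^ (a * ((finProdFinEquiv.symm k).2 : ℕ)) *
      (g ^ (a * b * (2 * p))) ^ ((finProdFinEquiv.symm k).1 : ℕ))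
    (fun _ => by positivity) (fun _ => by positivity)
    (sum_mul_pow_eq_zero hζ hp.one_lt fun i => g ^ (i : ℕ))
    (sum_mul_pow_eq_zero hξ hr.one_lt fun j => g ^ (a * (j : ℕ))) ?_⟩
  intro k l k' l' h
  obtain ⟨⟨s, i⟩, rfl⟩ := finProdFinEquiv.surjective k
  obtain ⟨⟨t, j⟩, rfl⟩ := finProdFinEquiv.surjective l
  obtain ⟨⟨s', i'⟩, rfl⟩ := finProdFinEquiv.surjective k'
  obtain ⟨⟨t', j'⟩, rfl⟩ := finProdFinEquiv.surjective l'
  simp only [Equiv.symm_apply_apply] at h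
  have key : ∀ i j s t : ℕ, (g ^ i * (g ^ (a * b * (2 * r))) ^ s *
      (g ^ (a * j) * (g ^ (a * b * (2 * p))) ^ t)) ^ 2 =
      (g ^ 2) ^ (i + a * j + a * b * (2 * (r * s + p * t))) := fun i j s t => by
    simp only [← pow_mul, ← pow_add]
    congr 1
    ring
  rw [key, key, (hsq.isOfFinOrder (by omega)).pow_eq_pow_iff_modEq, ← hsq.eq_orderOf] at h
  obtain ⟨⟨hi, hs⟩, hj, ht⟩ := mixed_radix_unique ((Nat.coprime_primes hp hr).mpr hne) hpo hro
    i.isLt i'.isLt j.isLt j'.isLt s.isLt s'.isLt t.isLt t'.isLt h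
  rw [Fin.ext hi, Fin.ext hs, Fin.ext hj, Fin.ext ht]
  exact ⟨rfl, rfl⟩
end

section
/- Let m, n > 2 be integers such that the pair (m,n) is optimal, i.e., there exist two distinct odd primes dividing m and n respectively, and neither m_o·rad(m_o) divides n_o nor n_o·rad(n_o) divides m_o, where m_o, n_o are the odd parts of m, n. Then lcm(m_o, n_o) can be written as a product m_1 n_1 where m_1 > 1 divides m_o, n_1 > 1 divides n_o, and gcd(m_1, n_1) = 1. -/
/-- The radical of a natural number: the product of its distinct prime divisors
(`rad 1 = 1`). -/
def rad (k : ℕ) : ℕ := ∏ p ∈ k.primeFactors, p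

/-- If every prime divisor of `a` occurs in `b` with strictly larger exponent, then
`a * rad a ∣ b`. -/
theorem mul_rad_dvd_of_factorization_lt {a b : ℕ} (ha : a ≠ 0) (hb : b ≠ 0)
    (h : ∀ p, p.Prime → p ∣ a → a.factorization p < b.factorization p) : a * rad a ∣ b := by
  have hab : a ∣ b := by
    rw [← Nat.factorization_prime_le_iff_dvd ha hb]
    intro p hp
    by_cases hpa : p ∣ a
    · exact (h p hp hpa).le
    · simp [Nat.factorization_eq_zero_of_not_dvd hpa]
  obtain ⟨c, rfl⟩ := hab
  have hc : c ≠ 0 := right_ne_zero_of_mul hb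
  refine mul_dvd_mul_left a (Finset.prod_primes_dvd c
    (fun p hp => (Nat.prime_of_mem_primeFactors hp).prime) fun p hp => ?_)
  have hlt := h p (Nat.prime_of_mem_primeFactors hp) (Nat.dvd_of_mem_primeFactors hp)
  rw [Nat.factorization_mul ha hc, Finsupp.add_apply] at hlt
  exact Nat.dvd_of_factorization_pos (by omega)

theorem dvd_factorizationLCMLeft {a b p : ℕ} (ha : a ≠ 0) (hb : b ≠ 0) (hp : p.Prime)
    (hpa : p ∣ a) (h : b.factorization p ≤ a.factorization p) :
    p ∣ Nat.factorizationLCMLeft a b := by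
  have hpl : p ∣ Nat.lcm a b := hpa.trans (Nat.dvd_lcm_left a b)
  have hl : Nat.lcm a b ≠ 0 := Nat.lcm_ne_zero ha hb
  have hmem : p ∈ (Nat.lcm a b).factorization.support := by
    simpa using ⟨hp, hpl, ha, hb⟩
  refine dvd_trans ?_ (Finset.dvd_prod_of_mem _ hmem)
  simp only [h, if_true]
  exact dvd_pow_self p (hp.factorization_pos_of_dvd hl hpl).ne'

theorem exists_coprime_mul_eq_lcm_of_not_dvd {a b : ℕ} (ha : a ≠ 0) (hb : b ≠ 0)
    (hba : ¬ b ∣ a) (h : ¬ a * rad a ∣ b) :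
    ∃ c d : ℕ, 1 < c ∧ 1 < d ∧ c ∣ a ∧ d ∣ b ∧ Nat.Coprime c d ∧ c * d = Nat.lcm a b := by
  have hmul := Nat.factorizationLCMLeft_mul_factorizationLCMRight ha hb
  have hdvd := Nat.factorizationLCMLeft_dvd_left a b
  refine ⟨Nat.factorizationLCMLeft a b, Nat.factorizationLCMRight a b, ?_, ?_, hdvd,
    Nat.factorizationLCMRight_dvd_right a b,
    Nat.coprime_factorizationLCMLeft_factorizationLCMRight a b, hmul⟩
  · have hpos := Nat.factorizationLCMLeft_pos a b
    by_contra hle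
    refine h (mul_rad_dvd_of_factorization_lt ha hb fun p hp hpa => ?_)
    by_contra hlt
    have hpd := dvd_factorizationLCMLeft ha hb hp hpa (not_lt.mp hlt)
    have := Nat.le_of_dvd hpos hpd
    have := hp.two_le
    omega
  · have hpos := Nat.factorizationLCMRight_pos a b
    by_contra hle
    have hone : Nat.factorizationLCMRight a b = 1 := by omega
    rw [hone, mul_one] at hmul
    exact hba ((Nat.dvd_lcm_right a b).trans (hmul ▸ hdvd))

/-- A number with two distinct prime divisors is a product of two coprime nontrivial factors. -/
theorem exists_coprime_mul_eq_self {a p q : ℕ} (ha : a ≠ 0) (hp : p.Prime) (hq : q.Prime)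
    (hpq : p ≠ q) (hpa : p ∣ a) (hqa : q ∣ a) :
    ∃ c d : ℕ, 1 < c ∧ 1 < d ∧ c ∣ a ∧ d ∣ a ∧ Nat.Coprime c d ∧ c * d = a := by
  refine ⟨ordProj[p] a, ordCompl[p] a,
    Nat.one_lt_pow (hp.factorization_pos_of_dvd ha hpa).ne' hp.one_lt, ?_,
    Nat.ordProj_dvd a p, Nat.ordCompl_dvd a p, (Nat.coprime_ordCompl hp ha).pow_left _,
    Nat.ordProj_mul_ordCompl_eq_self a p⟩
  have hqc : q ∣ ordCompl[p] a := by
    rw [← Nat.ordProj_mul_ordCompl_eq_self a p] at hqa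
    exact (((Nat.coprime_primes hq hp).mpr hpq.symm).pow_right _).dvd_of_dvd_mul_left hqa
  exact hq.one_lt.trans_le (Nat.le_of_dvd (Nat.ordCompl_pos p ha) hqc)

theorem dvd_ordCompl_two_of_odd {p m : ℕ} (hp : Odd p) (h : p ∣ m) : p ∣ ordCompl[2] m := by
  rw [← Nat.ordProj_mul_ordCompl_eq_self m 2] at h
  exact ((Nat.coprime_two_right.mpr hp).pow_right _).dvd_of_dvd_mul_left h

/-- If the pair `(m,n)` is optimal — there exist distinct odd primes
dividing `m` and `n` respectively, and neither `m_o·rad(m_o) ∣ n_o` nor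
`n_o·rad(n_o) ∣ m_o`, where `m_o = ordCompl[2] m`, `n_o = ordCompl[2] n` are the odd
parts — then `lcm(m_o, n_o) = m₁ n₁` for some coprime `m₁ > 1` dividing `m_o` and
`n₁ > 1` dividing `n_o`. -/
theorem heffter_stmt_16 (m n : ℕ) (hm : 2 < m) (hn : 2 < n)
    (hagree : ∃ p p' : ℕ, p.Prime ∧ p'.Prime ∧ Odd p ∧ Odd p' ∧ p ≠ p' ∧ p ∣ m ∧ p' ∣ n)
    (h1 : ¬ (ordCompl[2] m * rad (ordCompl[2] m) ∣ ordCompl[2] n))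
    (h2 : ¬ (ordCompl[2] n * rad (ordCompl[2] n) ∣ ordCompl[2] m)) :
    ∃ m₁ n₁ : ℕ, 1 < m₁ ∧ 1 < n₁ ∧ m₁ ∣ ordCompl[2] m ∧ n₁ ∣ ordCompl[2] n ∧
      Nat.Coprime m₁ n₁ ∧ m₁ * n₁ = Nat.lcm (ordCompl[2] m) (ordCompl[2] n) := by
  obtain ⟨p, q, hp, hq, hpo, hqo, hpq, hpm, hqn⟩ := hagree
  have hpa := dvd_ordCompl_two_of_odd hpo hpm
  have hqb := dvd_ordCompl_two_of_odd hqo hqn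
  have ha : ordCompl[2] m ≠ 0 := (Nat.ordCompl_pos 2 (by omega)).ne'
  have hb : ordCompl[2] n ≠ 0 := (Nat.ordCompl_pos 2 (by omega)).ne'
  generalize ordCompl[2] m = a at *
  generalize ordCompl[2] n = b at *
  by_cases hba : b ∣ a
  · by_cases hab : a ∣ b
    · obtain rfl := Nat.dvd_antisymm hab hba
      rw [Nat.lcm_self]
      exact exists_coprime_mul_eq_self ha hp hq hpq hpa hqb
    · obtain ⟨c, d, hc, hd, hcb, hda, hcop, hmul⟩ :=
        exists_coprime_mul_eq_lcm_of_not_dvd hb ha hab h2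
      exact ⟨d, c, hd, hc, hda, hcb, hcop.symm, by rw [mul_comm, hmul, Nat.lcm_comm]⟩
  · exact exists_coprime_mul_eq_lcm_of_not_dvd ha hb hba h1
end

section
/- Let A be a rank-one Heffter array H(m,n) over F_q, q = 2mn+1 a prime power, with entries a_{i,j} = x_i y_j where X = {x_1,…,x_m} and Y = {y_1,…,y_n} are subsets of F_q^* of sizes m and n. Then the stabilizer S = { u ∈ F_q^* : uX = X } has odd order dividing m, hence |S| divides the odd part m_o of m; likewise the stabilizer T = { u ∈ F_q^* : uY = Y } has odd order dividing n, hence |T| divides the odd part n_o of n. -/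
open scoped Classical Pointwise

/-- In a commutative group the stabilizer of a set `s` has order dividing `|s|`, as `s` is a union
of cosets of its stabilizer. -/
theorem card_stabilizer_dvd_ncard {G : Type*} [CommGroup G] (s : Set G) :
    Nat.card (MulAction.stabilizer G s) ∣ s.ncard := by
  set H := MulAction.stabilizer G s
  have hpre : (QuotientGroup.mk : G → G ⧸ H) ⁻¹' (QuotientGroup.mk '' s) = s := by
    refine Set.Subset.antisymm ?_ (Set.subset_preimage_image _ _)
    rintro a ⟨b, hb, hab⟩
    have hmem : b⁻¹ * a ∈ H := QuotientGroup.eq.mp hab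
    have := (MulAction.mem_stabilizer_set.mp hmem b).mpr hb
    simpa [mul_comm, mul_left_comm] using this
  have hcard := Nat.card_congr
    (QuotientGroup.preimageMkEquivSubgroupProdSet H (QuotientGroup.mk '' s))
  rw [hpre, Nat.card_prod] at hcard
  exact ⟨_, hcard⟩

/-- A half-set contains no element together with its negative. -/
theorem IsHalfSet.neg_notMem {F : Type*} [Field F] [Fintype F] {L : Finset F}
    (hL : IsHalfSet L) {a : F} (ha : a ∈ L) : -a ∉ L := by
  intro hna
  obtain ⟨hcard, hunion⟩ := hL
  have himage : (L.image fun z => -z).card = L.card :=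
    Finset.card_image_of_injective _ neg_injective
  have hinter : 0 < (L ∩ L.image fun z => -z).card :=
    Finset.card_pos.mpr ⟨a, Finset.mem_inter.mpr ⟨ha, Finset.mem_image.mpr ⟨-a, hna, neg_neg a⟩⟩⟩
  have hadd := Finset.card_union_add_card_inter L (L.image fun z => -z)
  have hcompl : (Finset.univ \ {0} : Finset F).card = Fintype.card F - 1 := by
    rw [Finset.card_sdiff_of_subset (Finset.subset_univ _)]
    simp
  rw [hunion, hcompl, himage] at hadd
  omega

/-- If the nonempty range of an injective family of nonzero elements contains no element together
with its negative, then its multiplicative stabilizer has odd order dividing its size. -/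
theorem odd_ncard_stabilizer_range {F : Type*} [Field F] [Fintype F] {m : ℕ} (hm : m ≠ 0)
    (x : Fin m → F) (hxinj : Function.Injective x) (hx0 : ∀ i, x i ≠ 0)
    (hneg : ∀ i k, x k ≠ -x i) :
    Odd {u : Fˣ | (fun z => (u : F) * z) '' Set.range x = Set.range x}.ncard ∧
      {u : Fˣ | (fun z => (u : F) * z) '' Set.range x = Set.range x}.ncard ∣ m ∧
      {u : Fˣ | (fun z => (u : F) * z) '' Set.range x = Set.range x}.ncard ∣ ordCompl[2] m := by
  let x' : Fin m → Fˣ := fun i => Units.mk0 (x i) (hx0 i)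
  have hx'inj : Function.Injective x' := fun i k h => hxinj (congrArg Units.val h)
  have hrange : Set.range x = Units.val '' Set.range x' := by
    rw [← Set.range_comp]
    rfl
  have hstab : {u : Fˣ | (fun z => (u : F) * z) '' Set.range x = Set.range x} =
      (MulAction.stabilizer Fˣ (Set.range x') : Set Fˣ) := by
    ext u
    have himage : (fun z => (u : F) * z) '' (Units.val '' Set.range x') =
        Units.val '' (u • Set.range x') := by
      rw [← Set.image_smul, Set.image_image, Set.image_image]
      rfl
    rw [Set.mem_ofPred_eq, hrange, himage, Units.val_injective.image_injective.eq_iff,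
      SetLike.mem_coe, MulAction.mem_stabilizer_iff]
  have hodd : Odd (Nat.card (MulAction.stabilizer Fˣ (Set.range x'))) := by
    rw [← Nat.not_even_iff_odd, even_iff_two_dvd]
    intro htwo
    obtain ⟨⟨u, hu⟩, hord⟩ := exists_prime_orderOf_dvd_card' 2 htwo
    rw [Subgroup.orderOf_mk] at hord
    have hsq : (u : F) * u = 1 := by
      have := pow_orderOf_eq_one u
      rw [hord, sq] at this
      exact congrArg Units.val this
    have hu1 : (u : F) ≠ 1 := by
      intro h
      rw [Units.val_eq_one.mp h, orderOf_one] at hord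
      omega
    have hum : (u : F) = -1 := (mul_self_eq_one_iff.mp hsq).resolve_left hu1
    have hmem := (MulAction.mem_stabilizer_set.mp hu (x' ⟨0, Nat.pos_of_ne_zero hm⟩)).mpr ⟨_, rfl⟩
    obtain ⟨k, hk⟩ := hmem
    refine hneg ⟨0, Nat.pos_of_ne_zero hm⟩ k ?_
    have := congrArg Units.val hk
    simpa [x', hum] using this
  have hdvd : Nat.card (MulAction.stabilizer Fˣ (Set.range x')) ∣ m := by
    have := card_stabilizer_dvd_ncard (Set.range x')
    rwa [← Set.image_univ, Set.ncard_image_of_injective _ hx'inj, Set.ncard_univ, Nat.card_fin,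
      Set.image_univ] at this
  have hncard : (MulAction.stabilizer Fˣ (Set.range x') : Set Fˣ).ncard =
      Nat.card (MulAction.stabilizer Fˣ (Set.range x')) := rfl
  rw [hstab, hncard]
  refine ⟨hodd, hdvd, ?_⟩
  have hcop := (Nat.coprime_two_right.mpr hodd).pow_right (m.factorization 2)
  exact hcop.dvd_of_dvd_mul_left (by rwa [Nat.ordProj_mul_ordCompl_eq_self])

/-- Let `A` be a rank-one Heffter array `H(m,n)` over `F_q` with
entries `a_{i,j} = x_i y_j`, where `X = {x_1,…,x_m}` and `Y = {y_1,…,y_n}` are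
subsets of `Fˣ` of sizes `m` and `n`. Then the stabilizer `S` of `X` in `Fˣ` has
odd order dividing `m`, hence `|S|` divides the odd part `m_o` of `m`; likewise the
stabilizer `T` of `Y` has odd order dividing `n`, hence `|T|` divides `n_o`. -/
theorem heffter_stmt_19 {F : Type*} [Field F] [Fintype F] {m n : ℕ}
    (x : Fin m → F) (y : Fin n → F)
    (hxinj : Function.Injective x) (hyinj : Function.Injective y)
    (hx0 : ∀ i, x i ≠ 0) (hy0 : ∀ j, y j ≠ 0)
    (hA : IsHeffter (Matrix.of fun i j => x i * y j)) :
    (Odd {u : Fˣ | (fun z => (u : F) * z) '' Set.range x = Set.range x}.ncard ∧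
      {u : Fˣ | (fun z => (u : F) * z) '' Set.range x = Set.range x}.ncard ∣ m ∧
      {u : Fˣ | (fun z => (u : F) * z) '' Set.range x = Set.range x}.ncard ∣ ordCompl[2] m) ∧
    (Odd {u : Fˣ | (fun z => (u : F) * z) '' Set.range y = Set.range y}.ncard ∧
      {u : Fˣ | (fun z => (u : F) * z) '' Set.range y = Set.range y}.ncard ∣ n ∧
      {u : Fˣ | (fun z => (u : F) * z) '' Set.range y = Set.range y}.ncard ∣ ordCompl[2] n) := by
  obtain ⟨hAinj, hhalf, -, -⟩ := hA
  have hpos : m * n ≠ 0 := by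
    have hcard := hhalf.1
    rw [Finset.card_image_of_injective _ hAinj, Finset.card_univ, Fintype.card_prod,
      Fintype.card_fin, Fintype.card_fin] at hcard
    have := Fintype.one_lt_card (α := F)
    omega
  obtain ⟨hm, hn⟩ := mul_ne_zero_iff.mp hpos
  have hentry : ∀ i j k l, x k * y l ≠ -(x i * y j) := by
    intro i j k l h
    have hmem : ∀ i j, x i * y j ∈
        Finset.image (fun p : Fin m × Fin n => Matrix.of (fun i j => x i * y j) p.1 p.2)
          Finset.univ :=
      fun i j => Finset.mem_image.mpr ⟨(i, j), Finset.mem_univ _, rfl⟩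
    exact hhalf.neg_notMem (hmem i j) (h ▸ hmem k l)
  refine ⟨odd_ncard_stabilizer_range hm x hxinj hx0 fun i k h => ?_,
    odd_ncard_stabilizer_range hn y hyinj hy0 fun j l h => ?_⟩
  · exact hentry i ⟨0, Nat.pos_of_ne_zero hn⟩ k ⟨0, Nat.pos_of_ne_zero hn⟩ (by rw [h, neg_mul])
  · exact hentry ⟨0, Nat.pos_of_ne_zero hm⟩ j ⟨0, Nat.pos_of_ne_zero hm⟩ l (by rw [h, mul_neg])
end
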